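/- arXiv:1301.2633 — 5 statements merged into one kernel-verified Lean document; each statement's English description precedes it below -/
import Mathlib

section
/- Let K be a group, and let H₁, H₂ be subgroups of K such that H₁ is contained in the center of K. Let N₁ be a normal subgroup of H₁, N₂ a normal subgroup of H₂, and φ : H₁/N₁ → H₂/N₂ a group isomorphism. Then the set G = { h₁ * h₂ : h₁ ∈ H₁, h₂ ∈ H₂, φ([h₁]) = [h₂] } (where [h] denotes the class of h in the respective quotient) is a subgroup of K, and its commutator subgroup equals the commutator subgroup of H₂: ⁅G, G⁆ = ⁅H₂, H₂⁆ as subgroups of K. -/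
open scoped commutatorElement

/-- Multiplying both arguments by central elements does not change a commutator. -/
theorem commutatorElement_mul_mul_of_mem_center {K : Type*} [Group K] {a b : K}
    (ha : a ∈ Subgroup.center K) (hb : b ∈ Subgroup.center K) (x y : K) :
    ⁅a * x, b * y⁆ = ⁅x, y⁆ := by
  rw [Subgroup.mem_center_iff] at ha hb
  calc ⁅a * x, b * y⁆ = a * (x * b) * y * x⁻¹ * a⁻¹ * y⁻¹ * b⁻¹ := by
        simp only [commutatorElement_def]; group
    _ = b * (a * (x * y * x⁻¹)) * a⁻¹ * y⁻¹ * b⁻¹ := by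
        rw [hb x, ← mul_assoc a b x, hb a]; group
    _ = b * (x * y * x⁻¹ * y⁻¹) * b⁻¹ := by
        rw [← ha (x * y * x⁻¹)]; group
    _ = ⁅x, y⁆ := by
        rw [← hb, mul_inv_cancel_right, commutatorElement_def]

/-- **Lemma 2.4 of the paper.** Let `K` be a group, `H₁ H₂ ≤ K` with `H₁` central,
`N₁ ⊴ H₁`, `N₂ ⊴ H₂` and `φ : H₁/N₁ ≃* H₂/N₂`. Then the set
`{h₁ * h₂ : h₁ ∈ H₁, h₂ ∈ H₂, φ [h₁] = [h₂]}` is (the carrier of) a subgroup `G` of `K`,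
and `⁅G, G⁆ = ⁅H₂, H₂⁆`. -/
theorem commutator_of_fibre_product {K : Type*} [Group K] (H₁ H₂ : Subgroup K)
    (hcentral : H₁ ≤ Subgroup.center K)
    (N₁ : Subgroup H₁) (N₂ : Subgroup H₂) [N₁.Normal] [N₂.Normal]
    (φ : (H₁ ⧸ N₁) ≃* (H₂ ⧸ N₂)) :
    ∃ G : Subgroup K,
      (G : Set K) = {k : K | ∃ (h₁ : H₁) (h₂ : H₂),
          k = (h₁ : K) * (h₂ : K) ∧
          φ (QuotientGroup.mk h₁) = QuotientGroup.mk h₂} ∧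
      ⁅G, G⁆ = ⁅H₂, H₂⁆ := by
  have hcomm (a b : H₁) (x y : K) : ⁅(a : K) * x, (b : K) * y⁆ = ⁅x, y⁆ :=
    commutatorElement_mul_mul_of_mem_center (hcentral a.2) (hcentral b.2) x y
  have hc (a : H₁) (x : K) : x * a = a * x := Subgroup.mem_center_iff.1 (hcentral a.2) x
  let G : Subgroup K :=
    { carrier := {k : K | ∃ (h₁ : H₁) (h₂ : H₂),
        k = (h₁ : K) * (h₂ : K) ∧ φ (QuotientGroup.mk h₁) = QuotientGroup.mk h₂}
      one_mem' := ⟨1, 1, by simp, by simp⟩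
      mul_mem' := by
        rintro _ _ ⟨a, x, rfl, hax⟩ ⟨b, y, rfl, hby⟩
        refine ⟨a * b, x * y, ?_, by simp [hax, hby]⟩
        push_cast
        rw [mul_assoc, ← mul_assoc (x : K), hc b x]
        simp only [mul_assoc]
      inv_mem' := by
        rintro _ ⟨a, x, rfl, hax⟩
        exact ⟨a⁻¹, x⁻¹, by rw [← hc a x]; push_cast; rw [mul_inv_rev], by simp [hax]⟩ }
  refine ⟨G, rfl, le_antisymm ?_ ?_⟩ <;> rw [Subgroup.commutator_le]
  · rintro _ ⟨a, x, rfl, -⟩ _ ⟨b, y, rfl, -⟩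
    rw [hcomm]
    exact Subgroup.commutator_mem_commutator x.2 y.2
  · have lift (x : H₂) : ∃ a : H₁, (a : K) * x ∈ G := by
      obtain ⟨a, ha⟩ := QuotientGroup.mk_surjective (φ.symm (QuotientGroup.mk x))
      exact ⟨a, a, x, rfl, by rw [ha, φ.apply_symm_apply]⟩
    intro x hx y hy
    obtain ⟨a, ha⟩ := lift ⟨x, hx⟩
    obtain ⟨b, hb⟩ := lift ⟨y, hy⟩
    rw [← hcomm a b]
    exact Subgroup.commutator_mem_commutator ha hb
end

section
/- Let n₁, n₂, n₃ ≥ 1, let d and a_{i,j} (for i ∈ {1,2,3}, 1 ≤ j ≤ n_i) be integers, and set n = n₁ + n₂ + n₃ + 1. Let U be the n × (n+3) integer matrix defined as follows. Rows are indexed by the vertex set V = {0} ∪ {(i,j) : i ∈ {1,2,3}, 1 ≤ j ≤ n_i} of the T-shaped tree in which 0 is adjacent to each (i,1) and (i,j) is adjacent to (i,j+1). Columns are indexed by V together with three extra indices c₁, c₂, c₃. For a vertex column w ∈ V, the entry U[v, w] is −d if v = w = 0, is −a_{i,j} if v = w = (i,j), is 1 if v and w are adjacent in the tree, and is 0 otherwise;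 the extra column cᵢ has entry 1 in row (i, n_i) and 0 in all other rows. Declare the following pairs of columns to be adjacent on one branch: (0, (i,1)) for each i, ((i,j), (i,j+1)) for 1 ≤ j ≤ n_i − 1, and ((i, n_i), cᵢ) for each i. Then for every such adjacent pair, the n+1 columns of U obtained by deleting the two columns of that pair generate ℤⁿ as a ℤ-module. -/
/-- Vertices of the T-shaped tree: the central vertex `none`, and the vertex `some ⟨i, j⟩`
representing the `(j+1)`-st vertex on the `i`-th branch (so `some ⟨i, j⟩` encodes the
vertex `(i, j+1)` of the paper). -/
def TVertex (N : Fin 3 → ℕ) : Type := Option ((i : Fin 3) × Fin (N i))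

/-- The extended intersection matrix `U`: rows are indexed by the vertices of the T-shaped
tree, columns by the vertices together with three extra columns `c₁, c₂, c₃`. The vertex
part is the intersection matrix (`−d` at the centre, `−a_{i,j}` on the diagonal of the
branches, `1` for adjacent vertices, `0` otherwise); the extra column `cᵢ` has a single
entry `1` in the row of the last vertex `(i, N i)` of the `i`-th branch. -/
def extIntersectionMatrix (N : Fin 3 → ℕ) (d : ℤ) (a : (i : Fin 3) → Fin (N i) → ℤ) :
    Matrix (TVertex N) (TVertex N ⊕ Fin 3) ℤ := fun v c =>
  match v, c with
  | none, Sum.inl none => -d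
  | none, Sum.inl (some ⟨_, j⟩) => if (j : ℕ) = 0 then 1 else 0
  | some ⟨_, j⟩, Sum.inl none => if (j : ℕ) = 0 then 1 else 0
  | some ⟨i, j⟩, Sum.inl (some ⟨i', j'⟩) =>
      if i = i' then
        (if (j : ℕ) = (j' : ℕ) then -(a i j)
         else if (j : ℕ) + 1 = (j' : ℕ) ∨ (j' : ℕ) + 1 = (j : ℕ) then 1 else 0)
      else 0
  | none, Sum.inr _ => 0
  | some ⟨i, j⟩, Sum.inr i' => if i = i' ∧ (j : ℕ) = N i - 1 then 1 else 0

/-- Two columns of the extended intersection matrix are *adjacent on one branch*: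
either the central column together with the first column of a branch, two consecutive
columns of a branch, or the last column of the `i`-th branch together with the extra
column `cᵢ`. -/
def AdjacentColumns (N : Fin 3 → ℕ) : (TVertex N ⊕ Fin 3) → (TVertex N ⊕ Fin 3) → Prop :=
  fun c₁ c₂ =>
  match c₁, c₂ with
  | Sum.inl none, Sum.inl (some ⟨_, j⟩) => (j : ℕ) = 0
  | Sum.inl (some ⟨i, j⟩), Sum.inl (some ⟨i', j'⟩) => i = i' ∧ (j : ℕ) + 1 = (j' : ℕ)
  | Sum.inl (some ⟨i, j⟩), Sum.inr i' => i = i' ∧ (j : ℕ) = N i - 1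
  | _, _ => False

/-- The standard basis vector at position `p` of branch `i`, where position `0` is the centre;
it vanishes beyond the end of the branch. -/
def branchVec (N : Fin 3 → ℕ) (i : Fin 3) (p : ℕ) : TVertex N → ℤ := fun v =>
  match v with
  | none => if p = 0 then 1 else 0
  | some ⟨i', j⟩ => if i' = i ∧ (j : ℕ) + 1 = p then 1 else 0

/-- The column index at position `p` of branch `i`, where position `0` is the centre and
position `N i + 1` is the extra column. -/
def branchCol (N : Fin 3 → ℕ) (i : Fin 3) (p : ℕ) : TVertex N ⊕ Fin 3 :=
  if p = 0 then Sum.inl none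
  else if h : p - 1 < N i then Sum.inl (some ⟨i, ⟨p - 1, h⟩⟩) else Sum.inr i

theorem branchCol_inj {N : Fin 3 → ℕ} {i i' : Fin 3} {p p' : ℕ} (hp : p ≠ 0)
    (hpN : p ≤ N i + 1) (hpN' : p' ≤ N i' + 1) (h : branchCol N i p = branchCol N i' p') :
    i = i' ∧ p = p' := by
  unfold branchCol at h
  rw [if_neg hp] at h
  split_ifs at h
  · cases Sum.inl.inj h
  · obtain ⟨rfl, h⟩ := Sigma.mk.inj (Option.some.inj (Sum.inl.inj h))
    have h := Fin.mk.inj (eq_of_heq h)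
    omega
  · cases Sum.inr.inj h
    omega

theorem branchCol_ne_zero {N : Fin 3 → ℕ} {i i' : Fin 3} {p : ℕ} (hp : p ≠ 0) :
    branchCol N i' 0 ≠ branchCol N i p := by
  unfold branchCol
  rw [if_pos rfl, if_neg hp]
  split_ifs
  · intro h
    cases Sum.inl.inj h
  · exact Sum.inl_ne_inr

theorem AdjacentColumns.exists_branchCol {N : Fin 3 → ℕ} {c₁ c₂ : TVertex N ⊕ Fin 3}
    (h : AdjacentColumns N c₁ c₂) :
    ∃ i k, k ≤ N i ∧ c₁ = branchCol N i k ∧ c₂ = branchCol N i (k + 1) := by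
  rcases c₁ with (_ | ⟨i, j⟩) | i <;> rcases c₂ with (_ | ⟨i', j'⟩) | i' <;>
    simp only [AdjacentColumns] at h
  · refine ⟨i', 0, Nat.zero_le _, rfl, ?_⟩
    obtain ⟨j', hj'⟩ := j'
    simp only at h
    subst h
    simp [branchCol, hj']
  · obtain ⟨rfl, h⟩ := h
    obtain ⟨j', hj'⟩ := j'
    simp only at h
    subst h
    refine ⟨i, j + 1, j.2, ?_, ?_⟩
    · simp [branchCol]
    · simp [branchCol, hj']
  · obtain ⟨rfl, h⟩ := h
    have := j.2
    refine ⟨i, j + 1, j.2, ?_, ?_⟩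
    · simp [branchCol]
    · have : ¬ (j : ℕ) + 1 < N i := by omega
      simp [branchCol, this]

theorem exists_extIntersectionMatrix_branchCol (N : Fin 3 → ℕ) (d : ℤ)
    (a : (i : Fin 3) → Fin (N i) → ℤ) (i : Fin 3) (p : ℕ) (hi : 1 ≤ N i)
    (hpN : p ≤ N i) :
    ∃ b : ℤ, (fun v => extIntersectionMatrix N d a v (branchCol N i (p + 1))) =
      branchVec N i p + b • branchVec N i (p + 1) + branchVec N i (p + 2) := by
  rcases hpN.lt_or_eq with h | rfl
  · refine ⟨-a i ⟨p, h⟩, funext fun v => ?_⟩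
    have hc : branchCol N i (p + 1) = Sum.inl (some ⟨i, ⟨p, h⟩⟩) := by
      simp only [branchCol, Nat.add_one_ne_zero, if_false, Nat.add_sub_cancel, h, dif_pos]
      rfl
    rw [hc, Pi.add_apply, Pi.add_apply, Pi.smul_apply, smul_eq_mul]
    rcases v with _ | ⟨i', j, hj⟩
    · simp [extIntersectionMatrix, branchVec]
    · by_cases hii : i' = i
      · subst hii
        by_cases hjp : j = p
        · subst hjp
          simp [extIntersectionMatrix, branchVec]
        · simp only [extIntersectionMatrix, branchVec, true_and, if_true]
          split_ifs <;> simp <;> omega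
      · simp [extIntersectionMatrix, branchVec, hii]
  · refine ⟨0, funext fun v => ?_⟩
    have hc : branchCol N i (N i + 1) = Sum.inr i := by
      simp [branchCol]
    rw [hc, Pi.add_apply, Pi.add_apply, Pi.smul_apply, smul_eq_mul]
    rcases v with _ | ⟨i', j, hj⟩
    · simp [extIntersectionMatrix, branchVec]
      omega
    · by_cases hii : i' = i
      · subst hii
        simp only [extIntersectionMatrix, branchVec, true_and]
        split_ifs <;> simp <;> omega
      · simp [extIntersectionMatrix, branchVec, hii]

theorem extIntersectionMatrix_center (N : Fin 3 → ℕ) (d : ℤ)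
    (a : (i : Fin 3) → Fin (N i) → ℤ) (i : Fin 3) :
    (fun v => extIntersectionMatrix N d a v (branchCol N i 0)) =
      -d • branchVec N i 0 + ∑ i', branchVec N i' 1 := by
  funext v
  rw [Pi.add_apply, Pi.smul_apply, smul_eq_mul, Finset.sum_apply]
  rcases v with _ | ⟨i', j⟩
  · simp [extIntersectionMatrix, branchVec, branchCol]
  · simp [extIntersectionMatrix, branchVec, branchCol, ite_and]

theorem branchVec_eq_zero {N : Fin 3 → ℕ} {i : Fin 3} {p : ℕ} (hp : N i < p) :
    branchVec N i p = 0 := by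
  funext v
  rw [Pi.zero_apply]
  rcases v with _ | ⟨i', j⟩
  · exact if_neg (by omega)
  · refine if_neg ?_
    rintro ⟨rfl, h⟩
    omega

theorem branchVec_zero (N : Fin 3 → ℕ) (i i' : Fin 3) : branchVec N i 0 = branchVec N i' 0 := by
  funext v
  rcases v with _ | ⟨_, j⟩ <;> simp [branchVec]

theorem eq_top_of_branchVec_mem {N : Fin 3 → ℕ} {S : Submodule ℤ (TVertex N → ℤ)}
    (h : ∀ i p, branchVec N i p ∈ S) : S = ⊤ := by
  classical
  have : Fintype (TVertex N) := inferInstanceAs (Fintype (Option _))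
  rw [eq_top_iff, ← (Pi.basisFun ℤ (TVertex N)).span_eq, Submodule.span_le]
  rintro _ ⟨v, rfl⟩
  rw [Pi.basisFun_apply, show (Pi.single v 1 : TVertex N → ℤ) = fun w => if w = v then 1 else 0
    from funext fun w => Pi.single_apply v 1 w]
  rcases v with _ | ⟨i, j⟩
  · refine Set.mem_of_eq_of_mem (funext fun w => ?_) (h 0 0)
    rcases w with _ | ⟨i', j'⟩
    · exact if_pos rfl
    · exact (if_neg fun h => Option.some_ne_none _ h).trans (if_neg (by simp)).symm
  · refine Set.mem_of_eq_of_mem (funext fun w => ?_) (h i (j + 1))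
    rcases w with _ | ⟨i', j'⟩
    · exact if_neg fun h => Option.some_ne_none _ h.symm
    · by_cases hij : i' = i ∧ (j' : ℕ) + 1 = j + 1
      · refine Eq.trans (if_pos ?_) (if_pos hij).symm
        obtain ⟨rfl, hj⟩ := hij
        obtain rfl : j' = j := Fin.ext (by omega)
        rfl
      · refine Eq.trans (if_neg fun h => hij ?_) (if_neg hij).symm
        cases h
        exact ⟨rfl, rfl⟩

section ThreeTerm

variable {R M : Type*} [Ring R] [AddCommGroup M] [Module R M] {S : Submodule R M} {e : ℕ → M}

theorem mem_of_three_term_down {m L : ℕ} (hL : ∀ p, L < p → e p ∈ S)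
    (h : ∀ p, m ≤ p → p ≤ L → ∃ b : R, e p + b • e (p + 1) + e (p + 2) ∈ S)
    {p : ℕ} (hp : m ≤ p) : e p ∈ S := by
  by_cases hpL : L < p
  · exact hL p hpL
  · obtain ⟨b, hb⟩ := h p hp (not_lt.mp hpL)
    have h1 : e (p + 1) ∈ S := mem_of_three_term_down hL h (by omega)
    have h2 : e (p + 2) ∈ S := mem_of_three_term_down hL h (by omega)
    rw [S.add_mem_iff_left h2, S.add_mem_iff_left (S.smul_mem b h1)] at hb
    exact hb
termination_by L + 1 - p

theorem mem_of_three_term_up {k : ℕ} (h0 : e 0 ∈ S) (h1 : e 1 ∈ S)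
    (h : ∀ p, p + 2 ≤ k → ∃ b : R, e p + b • e (p + 1) + e (p + 2) ∈ S) :
    ∀ p, p ≤ k → e p ∈ S
  | 0, _ => h0
  | 1, _ => h1
  | p + 2, hp => by
    obtain ⟨b, hb⟩ := h p hp
    have hp0 := mem_of_three_term_up h0 h1 h p (by omega)
    have hp1 := mem_of_three_term_up h0 h1 h (p + 1) (by omega)
    rwa [S.add_mem_iff_right (S.add_mem hp0 (S.smul_mem b hp1))] at hb

end ThreeTerm

/-- **Lemma 4.2 of the paper (the spanning lemma).** If from the extended intersection
matrix `U` we remove any two columns corresponding to a pair of adjacent vertices on one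
branch, the remaining columns generate `ℤⁿ` as a `ℤ`-module. -/
theorem spanning_lemma (N : Fin 3 → ℕ) (hN : ∀ i, 1 ≤ N i) (d : ℤ)
    (a : (i : Fin 3) → Fin (N i) → ℤ) (c₁ c₂ : TVertex N ⊕ Fin 3)
    (hadj : AdjacentColumns N c₁ c₂) :
    Submodule.span ℤ
        ((fun c (v : TVertex N) => extIntersectionMatrix N d a v c) ''
          {c | c ≠ c₁ ∧ c ≠ c₂}) = ⊤ := by
  obtain ⟨i₀, k, hk, rfl, rfl⟩ := hadj.exists_branchCol
  set S := Submodule.span ℤ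
    ((fun c (v : TVertex N) => extIntersectionMatrix N d a v c) ''
      {c | c ≠ branchCol N i₀ k ∧ c ≠ branchCol N i₀ (k + 1)})
  have hrel : ∀ i p, p ≤ N i → (i = i₀ → p + 1 ≠ k ∧ p ≠ k) →
      ∃ b : ℤ, branchVec N i p + b • branchVec N i (p + 1) + branchVec N i (p + 2) ∈ S := by
    intro i p hp hne
    obtain ⟨b, hb⟩ := exists_extIntersectionMatrix_branchCol N d a i p (hN i) hp
    refine ⟨b, hb ▸ Submodule.subset_span ⟨_, ⟨fun h => ?_, fun h => ?_⟩, rfl⟩⟩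
    · obtain ⟨hi, hpk⟩ := branchCol_inj (by omega) (by omega) (by omega) h
      exact (hne hi).1 hpk
    · obtain ⟨hi, hpk⟩ := branchCol_inj (by omega) (by omega) (by omega) h
      exact (hne hi).2 (by omega)
  have hend : ∀ i p, N i < p → branchVec N i p ∈ S := fun i p hp => by
    rw [branchVec_eq_zero hp]
    exact S.zero_mem
  have hother : ∀ i, i ≠ i₀ → ∀ p, branchVec N i p ∈ S := fun i hi p =>
    mem_of_three_term_down (hend i) (fun q _ hq => hrel i q hq fun h => absurd h hi)
      (Nat.zero_le p)
  have houter : ∀ p, k + 1 ≤ p → branchVec N i₀ p ∈ S := fun p hp =>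
    mem_of_three_term_down (hend i₀) (fun q hq hqN => hrel i₀ q hqN fun _ => by omega) hp
  have hzero : branchVec N i₀ 0 ∈ S := by
    obtain ⟨i, hi⟩ := exists_ne i₀
    rw [branchVec_zero N i₀ i]
    exact hother i hi 0
  have hone : branchVec N i₀ 1 ∈ S := by
    rcases Nat.eq_zero_or_pos k with rfl | hkpos
    · exact houter 1 le_rfl
    · have hc : -d • branchVec N i₀ 0 + ∑ i, branchVec N i 1 ∈ S := by
        rw [← extIntersectionMatrix_center N d a i₀]
        exact Submodule.subset_span
          ⟨_, ⟨branchCol_ne_zero (by omega), branchCol_ne_zero (by omega)⟩, rfl⟩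
      rw [S.add_mem_iff_right (S.smul_mem _ hzero),
        ← Finset.add_sum_erase _ _ (Finset.mem_univ i₀), S.add_mem_iff_left] at hc
      · exact hc
      · exact S.sum_mem fun i hi => hother i (Finset.ne_of_mem_erase hi) 1
  refine eq_top_of_branchVec_mem fun i p => ?_
  by_cases hi : i = i₀
  · subst hi
    rcases le_or_gt p k with hp | hp
    · exact mem_of_three_term_up hzero hone
        (fun q hq => hrel i q (by omega) fun _ => by omega) p hp
    · exact houter p hp
  · exact hother i hi p
end

section
/- Let σ be a type (of variables), let u, v, w ∈ σ be three pairwise distinct elements, and let m₁, m₂, m₃ be monic monomials in the polynomial ring ℂ[σ] (i.e. in MvPolynomial σ ℂ) whose variable supports are pairwise disjoint and disjoint from {u, v, w}. Then the polynomial f = X_u·m₁ + X_v·m₂ + X_w·m₃ is irreducible in ℂ[σ]. -/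
open MvPolynomial

/-- A sum of three distinct monic monomials is supported exactly on their exponents. -/
lemma MvPolynomial.support_monomial_add_monomial_add_monomial {σ R : Type*} [DecidableEq σ]
    [CommSemiring R] [Nontrivial R] {a b c : σ →₀ ℕ} (hab : a ≠ b) (hac : a ≠ c) (hbc : b ≠ c) :
    (monomial a (1 : R) + monomial b 1 + monomial c 1).support = {a, b, c} := by
  ext e
  simp only [mem_support_iff, coeff_add, coeff_monomial, Finset.mem_insert, Finset.mem_singleton]
  by_cases ha : e = a
  · subst ha
    simp [hab.symm, hac.symm]
  by_cases hb : e = b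
  · subst hb
    simp [hab, hbc.symm]
  simp [Ne.symm ha, Ne.symm hb, ha, hb, eq_comm]

/-- A sum of three monic monomials with pairwise disjoint nonempty supports, one of which contains
a variable with exponent `1`, is irreducible. -/
lemma MvPolynomial.irreducible_monomial_add_monomial_add_monomial {σ R : Type*} [DecidableEq σ]
    [CommRing R] [IsDomain R] {a b c : σ →₀ ℕ} {i : σ} (hi : a i = 1) (hb : b ≠ 0)
    (hab : Disjoint a.support b.support) (hac : Disjoint a.support c.support)
    (hbc : Disjoint b.support c.support) :
    Irreducible (monomial a (1 : R) + monomial b 1 + monomial c 1) := by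
  have ha : a ≠ 0 := by
    rintro rfl
    simp at hi
  have ne_of_disjoint {d e : σ →₀ ℕ} (hd : d ≠ 0) (h : Disjoint d.support e.support) :
      d ≠ e := by
    rintro rfl
    exact hd (by simpa using h)
  have hab' := ne_of_disjoint ha hab
  have hac' := ne_of_disjoint ha hac
  have hbc' := ne_of_disjoint hb hbc
  have hs := support_monomial_add_monomial_add_monomial (R := R) hab' hac' hbc'
  refine irreducible_of_disjoint_support (d := a) (i := i) ?_ ?_ hi ?_ ?_
  · rw [hs]
    exact ⟨a, by simp, b, by simp, hab'⟩
  · simp [hs]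
  · rw [hs]
    intro d hd e he hde
    simp only [Finset.coe_insert, Finset.coe_singleton, Set.mem_insert_iff,
      Set.mem_singleton_iff] at hd he
    rcases hd with rfl | rfl | rfl <;> rcases he with rfl | rfl | rfl <;>
      first | exact absurd rfl hde | assumption | exact Disjoint.symm ‹_›
  · intro r hr
    simpa [coeff_monomial, hab'.symm, hac'.symm, isUnit_iff_dvd_one] using hr a

/-- **Irreducibility of the trinomial of Construction 4.5 of the paper.** If `u, v, w` are
pairwise distinct variables and `m₁, m₂, m₃` are monic monomials in `ℂ[σ]` whose variable
supports are pairwise disjoint and disjoint from `{u, v, w}`, then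
`X_u·m₁ + X_v·m₂ + X_w·m₃` is irreducible. -/
theorem trinomial_irreducible {σ : Type*} [DecidableEq σ] (u v w : σ)
    (huv : u ≠ v) (huw : u ≠ w) (hvw : v ≠ w)
    (m₁ m₂ m₃ : MvPolynomial σ ℂ)
    (hm₁ : ∃ d : σ →₀ ℕ, m₁ = monomial d 1)
    (hm₂ : ∃ d : σ →₀ ℕ, m₂ = monomial d 1)
    (hm₃ : ∃ d : σ →₀ ℕ, m₃ = monomial d 1)
    (h12 : Disjoint m₁.vars m₂.vars) (h13 : Disjoint m₁.vars m₃.vars)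
    (h23 : Disjoint m₂.vars m₃.vars)
    (h1uvw : Disjoint m₁.vars ({u, v, w} : Finset σ))
    (h2uvw : Disjoint m₂.vars ({u, v, w} : Finset σ))
    (h3uvw : Disjoint m₃.vars ({u, v, w} : Finset σ)) :
    Irreducible (X u * m₁ + X v * m₂ + X w * m₃) := by
  obtain ⟨d₁, rfl⟩ := hm₁
  obtain ⟨d₂, rfl⟩ := hm₂
  obtain ⟨d₃, rfl⟩ := hm₃
  simp only [vars_monomial (one_ne_zero' ℂ), Finset.disjoint_insert_right,
    Finset.disjoint_singleton_right, Finsupp.mem_support_iff, not_not] at *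
  have support_eq {i : σ} {d : σ →₀ ℕ} (hd : d i = 0) :
      (Finsupp.single i 1 + d).support = insert i d.support := by
    rw [Finsupp.support_single_add (by simpa using hd) one_ne_zero, Finset.cons_eq_insert]
  simp only [X, monomial_mul, mul_one]
  apply irreducible_monomial_add_monomial_add_monomial (i := u)
  · simp [h1uvw.1]
  · intro h
    simpa using DFunLike.congr_fun h v
  all_goals
    simp_all [Finset.disjoint_insert_left, Finset.disjoint_insert_right, ne_comm]
end

section
/- Let σ be a type, let u, v, w ∈ σ be three pairwise distinct elements, and let m₁, m₂, m₃ be non-constant monic monomials in ℂ[σ] whose variable supports are pairwise disjoint and disjoint from {u, v, w}. Let f = X_u·m₁ + X_v·m₂ + X_w·m₃. If p : σ → ℂ is a point at which every partial derivative of f vanishes (i.e. eval_p(∂f/∂X_s) = 0 for all s ∈ σ), then for each i ∈ {1,2,3} there is a variable s_i in the support of m_i with p(s_i) = 0; in particular p vanishes at three pairwise distinct variables. -/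
open MvPolynomial

/-- If a monic monomial vanishes at `p`, then so does one of its variables. -/
theorem exists_mem_vars_eq_zero_of_eval_monomial_eq_zero {σ R : Type*} [CommSemiring R]
    [NoZeroDivisors R] [Nontrivial R] {d : σ →₀ ℕ} {p : σ → R}
    (h : eval p (monomial d (1 : R)) = 0) :
    ∃ s ∈ (monomial d (1 : R)).vars, p s = 0 := by
  rw [eval_monomial, one_mul, Finsupp.prod, Finset.prod_eq_zero_iff] at h
  obtain ⟨s, hs, h⟩ := h
  exact ⟨s, by rwa [vars_monomial one_ne_zero], eq_zero_of_pow_eq_zero h⟩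

/-- **Singular locus of the trinomial hypersurface (proof of Proposition 4.4 of the
paper).** Let `u, v, w` be pairwise distinct variables and `m₁, m₂, m₃` non-constant monic
monomials in `ℂ[σ]` with pairwise disjoint variable supports, disjoint from `{u, v, w}`.
If all partial derivatives of `f = X_u·m₁ + X_v·m₂ + X_w·m₃` vanish at a point `p`, then
for each `i` some variable `sᵢ` in the support of `mᵢ` satisfies `p sᵢ = 0`; in particular
`p` vanishes at three pairwise distinct variables. -/
theorem trinomial_singular_point_vanishes {σ : Type*} [DecidableEq σ] (u v w : σ)
    (huv : u ≠ v) (huw : u ≠ w) (hvw : v ≠ w)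
    (m₁ m₂ m₃ : MvPolynomial σ ℂ)
    (hm₁ : ∃ d : σ →₀ ℕ, m₁ = monomial d 1)
    (hm₂ : ∃ d : σ →₀ ℕ, m₂ = monomial d 1)
    (hm₃ : ∃ d : σ →₀ ℕ, m₃ = monomial d 1)
    (hm₁' : m₁.vars.Nonempty) (hm₂' : m₂.vars.Nonempty) (hm₃' : m₃.vars.Nonempty)
    (h12 : Disjoint m₁.vars m₂.vars) (h13 : Disjoint m₁.vars m₃.vars)
    (h23 : Disjoint m₂.vars m₃.vars)
    (h1uvw : Disjoint m₁.vars ({u, v, w} : Finset σ))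
    (h2uvw : Disjoint m₂.vars ({u, v, w} : Finset σ))
    (h3uvw : Disjoint m₃.vars ({u, v, w} : Finset σ))
    (p : σ → ℂ)
    (hp : ∀ s : σ, eval p (pderiv s (X u * m₁ + X v * m₂ + X w * m₃)) = 0) :
    ∃ s₁ ∈ m₁.vars, ∃ s₂ ∈ m₂.vars, ∃ s₃ ∈ m₃.vars,
      p s₁ = 0 ∧ p s₂ = 0 ∧ p s₃ = 0 ∧ s₁ ≠ s₂ ∧ s₁ ≠ s₃ ∧ s₂ ≠ s₃ := by
  simp only [Finset.disjoint_insert_right, Finset.disjoint_singleton_right] at h1uvw h2uvw h3uvw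
  obtain ⟨h1u, h1v, h1w⟩ := h1uvw
  obtain ⟨h2u, h2v, h2w⟩ := h2uvw
  obtain ⟨h3u, h3v, h3w⟩ := h3uvw
  have e₁ : eval p m₁ = 0 := by
    simpa [Derivation.leibniz, pderiv_X_of_ne huv.symm, pderiv_X_of_ne huw.symm,
      pderiv_eq_zero_of_notMem_vars h1u, pderiv_eq_zero_of_notMem_vars h2u,
      pderiv_eq_zero_of_notMem_vars h3u] using hp u
  have e₂ : eval p m₂ = 0 := by
    simpa [Derivation.leibniz, pderiv_X_of_ne huv, pderiv_X_of_ne hvw.symm,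
      pderiv_eq_zero_of_notMem_vars h1v, pderiv_eq_zero_of_notMem_vars h2v,
      pderiv_eq_zero_of_notMem_vars h3v] using hp v
  have e₃ : eval p m₃ = 0 := by
    simpa [Derivation.leibniz, pderiv_X_of_ne huw, pderiv_X_of_ne hvw,
      pderiv_eq_zero_of_notMem_vars h1w, pderiv_eq_zero_of_notMem_vars h2w,
      pderiv_eq_zero_of_notMem_vars h3w] using hp w
  obtain ⟨d₁, rfl⟩ := hm₁
  obtain ⟨d₂, rfl⟩ := hm₂
  obtain ⟨d₃, rfl⟩ := hm₃
  obtain ⟨s₁, hs₁, hp₁⟩ := exists_mem_vars_eq_zero_of_eval_monomial_eq_zero e₁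
  obtain ⟨s₂, hs₂, hp₂⟩ := exists_mem_vars_eq_zero_of_eval_monomial_eq_zero e₂
  obtain ⟨s₃, hs₃, hp₃⟩ := exists_mem_vars_eq_zero_of_eval_monomial_eq_zero e₃
  exact ⟨s₁, hs₁, s₂, hs₂, s₃, hs₃, hp₁, hp₂, hp₃, Finset.disjoint_iff_ne.mp h12 s₁ hs₁ s₂ hs₂,
    Finset.disjoint_iff_ne.mp h13 s₁ hs₁ s₃ hs₃, Finset.disjoint_iff_ne.mp h23 s₂ hs₂ s₃ hs₃⟩
end

section
/- Let σ be a type, let u, v, w ∈ σ be three pairwise distinct elements, and let m₁, m₂, m₃ be monic monomials in ℂ[σ] whose variable supports are pairwise disjoint and disjoint from {u, v, w}. Let f = X_u·m₁ + X_v·m₂ + X_w·m₃ and let R = ℂ[σ]/(f) be the quotient of the polynomial ring by the principal ideal generated by f. Then every unit of R is the image of a nonzero constant: if α ∈ R is invertible, then there exists c ∈ ℂ, c ≠ 0, such that α is the residue class of the constant polynomial c. -/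
open MvPolynomial

namespace MvPolynomial

/-- Over a domain, the variables of a divisor of a nonzero polynomial occur in that polynomial. -/
lemma vars_subset_of_dvd {σ R : Type*} [CommRing R] [IsDomain R] {p q : MvPolynomial σ R}
    (hq : q ≠ 0) (h : p ∣ q) : p.vars ⊆ q.vars := by
  obtain ⟨r, rfl⟩ := h
  intro i hi
  rw [mem_vars_iff_degreeOf_ne_zero] at hi ⊢
  rw [degreeOf_mul_eq (left_ne_zero_of_mul hq) (right_ne_zero_of_mul hq)]
  omega

/-- Nonzero polynomials over a field with no common variable are relatively prime. -/
lemma isRelPrime_of_disjoint_vars {σ K : Type*} [Field K] {p q : MvPolynomial σ K}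
    (hp : p ≠ 0) (hq : q ≠ 0) (h : Disjoint p.vars q.vars) : IsRelPrime p q := by
  intro d hdp hdq
  have hd : d.vars = ∅ := Finset.disjoint_self_iff_empty _ |>.mp <|
    h.mono (vars_subset_of_dvd hp hdp) (vars_subset_of_dvd hq hdq)
  rw [vars_eq_empty_iff_eq_C] at hd
  rw [hd]
  refine (IsUnit.mk0 _ fun h0 ↦ hp ?_).map C
  rw [h0, C_0] at hd
  exact zero_dvd_iff.mp (hd ▸ hdp)

/-- Substituting `X s ↦ x s * T ^ ω s` multiplies the value at `x` of a weighted homogeneous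
polynomial of weight `n` by `T ^ n`. -/
lemma IsWeightedHomogeneous.aeval_C_mul_X_pow {σ R A : Type*} [CommRing R] [CommRing A]
    [Algebra R A] {ω : σ → ℕ} {n : ℕ} {p : MvPolynomial σ R} (hp : IsWeightedHomogeneous ω p n)
    (x : σ → A) :
    aeval (fun s ↦ Polynomial.C (x s) * Polynomial.X ^ ω s) p =
      Polynomial.C (aeval x p) * Polynomial.X ^ n := by
  rw [aeval_def, aeval_def, eval₂_eq, eval₂_eq, map_sum, Finset.sum_mul]
  refine Finset.sum_congr rfl fun d hd ↦ ?_
  have hdn : ∑ i ∈ d.support, ω i * d i = n := by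
    rw [← hp (mem_support_iff.mp hd), Finsupp.weight_apply, Finsupp.sum]
    simp [mul_comm]
  simp only [mul_pow, Finset.prod_mul_distrib, ← pow_mul, Finset.prod_pow_eq_pow_sum, hdn,
    map_mul, map_prod, map_pow, Polynomial.algebraMap_apply, mul_assoc]

/-- If `f` is a prime polynomial, weighted homogeneous for positive weights, then every unit of
the quotient by `f` is the class of a constant. -/
lemma exists_mk_C_eq_of_isUnit_of_isWeightedHomogeneous {σ K : Type*} [Field K] {ω : σ → ℕ}
    (hω : ∀ s, 0 < ω s) {n : ℕ} {f : MvPolynomial σ K} (hf : IsWeightedHomogeneous ω f n)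
    (hprime : Prime f) {α : MvPolynomial σ K ⧸ Ideal.span {f}} (hα : IsUnit α) :
    ∃ c : K, c ≠ 0 ∧ α = Ideal.Quotient.mk (Ideal.span {f}) (C c) := by
  have hI : (Ideal.span {f}).IsPrime := (Ideal.span_singleton_prime hprime.ne_zero).mpr hprime
  let A := MvPolynomial σ K ⧸ Ideal.span {f}
  let π : MvPolynomial σ K →ₐ[K] A := Ideal.Quotient.mkₐ K (Ideal.span {f})
  let ψ : MvPolynomial σ K →ₐ[K] Polynomial A :=
    aeval fun s ↦ Polynomial.C (π (X s)) * Polynomial.X ^ ω s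
  have hπ : aeval (fun s ↦ π (X s)) = π := by ext; simp
  have hψ : ∀ a ∈ Ideal.span {f}, ψ a = 0 := by
    intro a ha
    obtain ⟨b, rfl⟩ := Ideal.mem_span_singleton.mp ha
    have hπf : π f = 0 := Ideal.Quotient.eq_zero_iff_mem.mpr (Ideal.mem_span_singleton_self f)
    have hψf : ψ f = 0 := by
      rw [hf.aeval_C_mul_X_pow, hπ, hπf, Polynomial.C_0, zero_mul]
    rw [map_mul, hψf, zero_mul]
  let φ : A →ₐ[K] Polynomial A := Ideal.Quotient.liftₐ _ ψ hψ
  have h1 (p) : (ψ p).eval 1 = π p := by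
    change ((Polynomial.aeval (1 : A)).restrictScalars K |>.comp ψ) p = π p
    congr 1
    ext
    simp [ψ]
  have h0 (p) : (ψ p).eval 0 = π (C (constantCoeff p)) := by
    have h : ((Polynomial.aeval (0 : A)).restrictScalars K).comp ψ =
        π.comp ((Algebra.ofId K _).comp (aeval (0 : σ → K))) := by
      ext s
      simp [ψ, (hω s).ne']
    simpa [Algebra.ofId_apply, Polynomial.coe_aeval_eq_eval] using DFunLike.congr_fun h p
  obtain ⟨p, rfl⟩ := Ideal.Quotient.mk_surjective α
  obtain ⟨r, -, hr⟩ := Polynomial.isUnit_iff.mp (hα.map φ)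
  have hp : π p = π (C (constantCoeff p)) := by
    change _ = ψ p at hr
    rw [← h0, ← h1, ← hr, Polynomial.eval_C, Polynomial.eval_C]
  refine ⟨constantCoeff p, fun hc ↦ ?_, hp⟩
  rw [hc, C_0, map_zero] at hp
  exact hα.ne_zero hp

end MvPolynomial

/-- **Units of the coordinate ring of the trinomial hypersurface are constants (proof of
Theorem 6.3 of the paper).** Let `u, v, w` be pairwise distinct variables and
`m₁, m₂, m₃` monic monomials in `ℂ[σ]` with pairwise disjoint variable supports, disjoint
from `{u, v, w}`, and let `f = X_u·m₁ + X_v·m₂ + X_w·m₃`. Then every unit of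
`ℂ[σ]/(f)` is the residue class of a nonzero constant. -/
theorem trinomial_quotient_units_are_constants {σ : Type*} [DecidableEq σ] (u v w : σ)
    (huv : u ≠ v) (huw : u ≠ w) (hvw : v ≠ w)
    (m₁ m₂ m₃ : MvPolynomial σ ℂ)
    (hm₁ : ∃ d : σ →₀ ℕ, m₁ = monomial d 1)
    (hm₂ : ∃ d : σ →₀ ℕ, m₂ = monomial d 1)
    (hm₃ : ∃ d : σ →₀ ℕ, m₃ = monomial d 1)
    (h12 : Disjoint m₁.vars m₂.vars) (h13 : Disjoint m₁.vars m₃.vars)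
    (h23 : Disjoint m₂.vars m₃.vars)
    (h1uvw : Disjoint m₁.vars ({u, v, w} : Finset σ))
    (h2uvw : Disjoint m₂.vars ({u, v, w} : Finset σ))
    (h3uvw : Disjoint m₃.vars ({u, v, w} : Finset σ))
    (f : MvPolynomial σ ℂ) (hf : f = X u * m₁ + X v * m₂ + X w * m₃)
    (α : MvPolynomial σ ℂ ⧸ Ideal.span {f}) (hα : IsUnit α) :
    ∃ c : ℂ, c ≠ 0 ∧ α = Ideal.Quotient.mk (Ideal.span {f}) (C c) := by
  obtain ⟨d₁, rfl⟩ := hm₁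
  obtain ⟨d₂, rfl⟩ := hm₂
  obtain ⟨d₃, rfl⟩ := hm₃
  have hne (d : σ →₀ ℕ) : monomial d (1 : ℂ) ≠ 0 := by simp
  simp only [vars_monomial one_ne_zero] at h12 h13 h23 h1uvw h2uvw h3uvw
  simp only [Finset.disjoint_insert_right, Finset.disjoint_singleton_right] at h1uvw h2uvw h3uvw
  obtain ⟨hu1, hv1, hw1⟩ := h1uvw
  obtain ⟨hu2, hv2, hw2⟩ := h2uvw
  obtain ⟨hu3, hv3, hw3⟩ := h3uvw
  have hvars (s : σ) (d : σ →₀ ℕ) :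
      (X s * monomial d (1 : ℂ)).vars ⊆ insert s d.support := by
    refine (vars_mul _ _).trans ?_
    rw [vars_X, vars_monomial one_ne_zero, Finset.insert_eq]
  have hg : Irreducible (X v * monomial d₂ (1 : ℂ) + X w * monomial d₃ 1) := by
    rw [mul_comm (X v)]
    refine irreducible_mul_X_add _ _ _ (hne _) ?_ (fun h ↦ ?_)
      (isRelPrime_of_disjoint_vars (hne _) (by simp) ?_)
    · rwa [vars_monomial one_ne_zero]
    · simpa [hvw, Finsupp.mem_support_iff.not.mp hv3] using hvars _ _ h
    · rw [vars_monomial one_ne_zero]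
      exact (Finset.disjoint_insert_right.mpr ⟨hw2, h23⟩).mono_right (hvars _ _)
  have hgvars : (X v * monomial d₂ (1 : ℂ) + X w * monomial d₃ 1).vars ⊆
      insert v d₂.support ∪ insert w d₃.support :=
    (vars_add_subset _ _).trans (Finset.union_subset_union (hvars _ _) (hvars _ _))
  have hprime : Prime f := by
    rw [← irreducible_iff_prime, hf, add_assoc, mul_comm (X u)]
    refine irreducible_mul_X_add _ _ _ (hne _) ?_ (fun h ↦ ?_)
      (isRelPrime_of_disjoint_vars (hne _) hg.ne_zero ?_)
    · rwa [vars_monomial one_ne_zero]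
    · have := hgvars h
      simp only [Finset.mem_union, Finset.mem_insert] at this
      tauto
    · rw [vars_monomial one_ne_zero]
      refine Disjoint.mono_right hgvars ?_
      simp only [Finset.disjoint_union_right, Finset.disjoint_insert_right]
      exact ⟨⟨hv1, h12⟩, hw1, h13⟩
  let ω : σ → ℕ := fun s ↦
    if s = u then 1 + d₂.degree + d₃.degree
    else if s = v then 1 + d₁.degree + d₃.degree
    else if s = w then 1 + d₁.degree + d₂.degree
    else 1
  have hω (s : σ) : 0 < ω s := by
    simp only [ω]
    split_ifs <;> omega
  have hdeg {d : σ →₀ ℕ} (hu : u ∉ d.support) (hv : v ∉ d.support) (hw : w ∉ d.support) :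
      Finsupp.weight ω d = d.degree := by
    rw [Finsupp.weight_apply, Finsupp.sum, Finsupp.degree_apply]
    refine Finset.sum_congr rfl fun s hs ↦ ?_
    have hsu : s ≠ u := fun h ↦ hu (h ▸ hs)
    have hsv : s ≠ v := fun h ↦ hv (h ▸ hs)
    have hsw : s ≠ w := fun h ↦ hw (h ▸ hs)
    simp [ω, hsu, hsv, hsw]
  have hhom {s : σ} {d : σ →₀ ℕ} (h : ω s + Finsupp.weight ω d =
      1 + d₁.degree + d₂.degree + d₃.degree) : IsWeightedHomogeneous ω
        (X s * monomial d (1 : ℂ)) (1 + d₁.degree + d₂.degree + d₃.degree) :=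
    h ▸ (isWeightedHomogeneous_X ℂ ω s).mul (isWeightedHomogeneous_monomial ω d 1 rfl)
  have hfhom : IsWeightedHomogeneous ω f (1 + d₁.degree + d₂.degree + d₃.degree) := by
    rw [hf]
    refine ((hhom ?_).add (hhom ?_)).add (hhom ?_)
    · rw [hdeg hu1 hv1 hw1]
      simp only [ω, if_true]
      omega
    · rw [hdeg hu2 hv2 hw2]
      simp only [ω, huv.symm, if_true, if_false]
      omega
    · rw [hdeg hu3 hv3 hw3]
      simp only [ω, huw.symm, hvw.symm, if_true, if_false]
  exact exists_mk_C_eq_of_isUnit_of_isWeightedHomogeneous hω hfhom hprime hα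
end
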